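/- Let b, c, d, e, g be real (or complex) parameters with e and g not nonpositive integers, and let z(x,y) = F^{0;2;1}_{1;0;1}[-: b,c; d; e: -; g; x,y]. Then on the domain |x| < 1 (all y), z satisfies the third-order partial differential equation y² z_yyy + x y z_xyy + g x z_xy + (e+g+1) y z_yy + (e g - y) z_y - d z = 0. -/

import Mathlib

noncomputable section

/-- The Pochhammer symbol `(a)_k = a (a+1) ⋯ (a+k-1)`. -/
def poch (a : ℝ) (k : ℕ) : ℝ := ∏ i ∈ Finset.range k, (a + i)
/-- The degenerate hypergeometric function of two variables of the third order
`F^{0;2;1}_{1;0;1}[-: b,c; d; e: -; g; x,y]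
  = ∑_{m,n≥0} (b)_m (c)_m (d)_n / ((e)_{m+n} (g)_n m! n!) x^m y^n`. -/
def F021 (b c d e g x y : ℝ) : ℝ :=
  ∑' mn : ℕ × ℕ,
    poch b mn.1 * poch c mn.1 * poch d mn.2 /
      (poch e (mn.1 + mn.2) * poch g mn.2 * mn.1.factorial * mn.2.factorial) *
      x ^ mn.1 * y ^ mn.2

/-- Coefficient growth condition. -/
def Good (A : ℕ → ℕ → ℝ) : Prop :=
  ∀ q : ℝ, 1 < q → ∀ ρ : ℝ, 0 < ρ → ∃ C : ℝ, 0 ≤ C ∧ ∀ m n, |A m n| ≤ C * q ^ m * ρ ^ n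

def SS (A : ℕ → ℕ → ℝ) (x y : ℝ) : ℝ := ∑' p : ℕ × ℕ, A p.1 p.2 * x ^ p.1 * y ^ p.2

def DDy (A : ℕ → ℕ → ℝ) : ℕ → ℕ → ℝ := fun m n => ((n : ℝ) + 1) * A m (n + 1)

lemma nat_le_pow (q : ℝ) (hq : 1 < q) (n : ℕ) : (n : ℝ) ≤ 1 / (q - 1) * q ^ n := by
  have h := one_add_mul_sub_le_pow (a := q) (by linarith) n
  have h1 : 0 < q - 1 := by linarith
  rw [div_mul_eq_mul_div, le_div_iff₀ h1]
  linarith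

lemma Good.mulm {A : ℕ → ℕ → ℝ} (h : Good A) : Good (fun m n => (m : ℝ) * A m n) := by
  intro q hq ρ hρ
  have hs : 1 < √q := by rw [Real.lt_sqrt] <;> linarith
  have hsq : √q * √q = q := Real.mul_self_sqrt (by linarith)
  obtain ⟨C, hC, H⟩ := h (√q) hs ρ hρ
  have hi : 0 < √q - 1 := by linarith
  refine ⟨1 / (√q - 1) * C, by positivity, fun m n => ?_⟩
  rw [abs_mul, abs_of_nonneg (by positivity : (0:ℝ) ≤ m)]
  calc (m : ℝ) * |A m n| ≤ (1 / (√q - 1) * √q ^ m) * (C * √q ^ m * ρ ^ n) := by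
        gcongr
        · exact nat_le_pow _ hs m
        · exact H m n
    _ = 1 / (√q - 1) * C * (√q * √q) ^ m * ρ ^ n := by rw [mul_pow]; ring
    _ = _ := by rw [hsq]

lemma Good.muln {A : ℕ → ℕ → ℝ} (h : Good A) : Good (fun m n => (n : ℝ) * A m n) := by
  intro q hq ρ hρ
  obtain ⟨C, hC, H⟩ := h q hq (ρ / 2) (by positivity)
  refine ⟨C, hC, fun m n => ?_⟩
  rw [abs_mul, abs_of_nonneg (by positivity : (0:ℝ) ≤ n)]
  have h2 := nat_le_pow 2 (by norm_num) n
  norm_num at h2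
  have hq0 : 0 < q := by linarith
  calc (n : ℝ) * |A m n| ≤ 2 ^ n * (C * q ^ m * (ρ / 2) ^ n) := by
        gcongr
        exact H m n
    _ = C * q ^ m * ρ ^ n := by rw [div_pow]; field_simp

lemma Good.shift {A : ℕ → ℕ → ℝ} (h : Good A) : Good (fun m n => A m (n + 1)) := by
  intro q hq ρ hρ
  obtain ⟨C, hC, H⟩ := h q hq ρ hρ
  refine ⟨C * ρ, by positivity, fun m n => ?_⟩
  refine (H m (n + 1)).trans (le_of_eq ?_)
  ring

lemma Good.DDy {A : ℕ → ℕ → ℝ} (h : Good A) : Good (DDy A) := by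
  have := h.muln.shift
  have e : _root_.DDy A = fun m n => ((n + 1 : ℕ) : ℝ) * A m (n + 1) := by
    funext m n; simp [_root_.DDy]
  rw [e]
  exact this

lemma Good.sub {A B : ℕ → ℕ → ℝ} (hA : Good A) (hB : Good B) :
    Good (fun m n => A m n - B m n) := by
  intro q hq ρ hρ
  obtain ⟨C, hC, H⟩ := hA q hq ρ hρ
  obtain ⟨D, hD, K⟩ := hB q hq ρ hρ
  refine ⟨C + D, by positivity, fun m n => ?_⟩
  have h1 := abs_sub (A m n) (B m n)
  have h2 := H m n
  have h3 := K m n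
  linarith

lemma Good.summable_abs {A : ℕ → ℕ → ℝ} (h : Good A) (r R : ℝ) (hr : 0 ≤ r) (hr1 : r < 1)
    (hR : 0 ≤ R) : Summable (fun p : ℕ × ℕ => |A p.1 p.2| * r ^ p.1 * R ^ p.2) := by
  have hq : (1:ℝ) < 2 / (1 + r) := by rw [lt_div_iff₀] <;> linarith
  obtain ⟨C, hC, H⟩ := h (2 / (1 + r)) hq (1 / (R + 1)) (by positivity)
  have s1 : Summable (fun m : ℕ => (2 / (1 + r) * r) ^ m) := by
    apply summable_geometric_of_lt_one (by positivity)
    rw [div_mul_eq_mul_div, div_lt_one] <;> linarith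
  have s2 : Summable (fun m : ℕ => (1 / (R + 1) * R) ^ m) := by
    apply summable_geometric_of_lt_one (by positivity)
    rw [div_mul_eq_mul_div, div_lt_one] <;> linarith
  have s3 := (s1.mul_of_nonneg s2 (fun _ => by positivity) (fun _ => by positivity)).mul_left C
  refine Summable.of_nonneg_of_le (fun p => by positivity) (fun p => ?_) s3
  calc |A p.1 p.2| * r ^ p.1 * R ^ p.2
      ≤ (C * (2 / (1 + r)) ^ p.1 * (1 / (R + 1)) ^ p.2) * r ^ p.1 * R ^ p.2 := by
        gcongr
        exact H _ _
    _ = _ := by rw [mul_pow, mul_pow]; ring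

lemma Good.summable {A : ℕ → ℕ → ℝ} (h : Good A) (x y : ℝ) (hx : |x| < 1) :
    Summable (fun p : ℕ × ℕ => A p.1 p.2 * x ^ p.1 * y ^ p.2) := by
  apply Summable.of_norm
  have := h.summable_abs |x| |y| (abs_nonneg _) hx (abs_nonneg _)
  simpa [abs_mul, abs_pow] using this

lemma Good.hasSum {A : ℕ → ℕ → ℝ} (h : Good A) (x y : ℝ) (hx : |x| < 1) :
    HasSum (fun p : ℕ × ℕ => A p.1 p.2 * x ^ p.1 * y ^ p.2) (SS A x y) :=
  (h.summable x y hx).hasSum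

lemma tsum_shift (f : ℕ × ℕ → ℝ) (hf : ∀ m, f (m, 0) = 0) :
    ∑' p : ℕ × ℕ, f (p.1, p.2 + 1) = ∑' p, f p := by
  have hi : Function.Injective (fun p : ℕ × ℕ => (p.1, p.2 + 1)) := by
    rintro ⟨a, b⟩ ⟨c, d⟩ h
    simpa using h
  apply hi.tsum_eq (f := f)
  rintro ⟨m, n⟩ h
  cases n with
  | zero => exact absurd (hf m) h
  | succ n => exact ⟨(m, n), rfl⟩

lemma pow_bound (t R : ℝ) (hR : 0 < R) (ht : |t| ≤ R) (n : ℕ) :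
    |(n : ℝ) * t ^ (n - 1)| ≤ n * R ^ n * (1 / R) := by
  cases n with
  | zero => simp
  | succ n =>
    rw [abs_mul, abs_pow, abs_of_nonneg (by positivity : (0:ℝ) ≤ ((n + 1 : ℕ) : ℝ)), mul_assoc]
    gcongr
    have : R ^ (n + 1) * (1 / R) = R ^ n := by rw [pow_succ]; field_simp
    rw [this]
    simp only [Nat.add_sub_cancel]
    gcongr

lemma Good.hasDerivAt_y {A : ℕ → ℕ → ℝ} (h : Good A) (x y : ℝ) (hx : |x| < 1) :
    HasDerivAt (fun y' => SS A x y') (SS (_root_.DDy A) x y) y := by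
  have hR : 0 < |y| + 1 := by positivity
  have key := hasDerivAt_tsum_of_isPreconnected
    (g := fun (p : ℕ × ℕ) y' => A p.1 p.2 * x ^ p.1 * y' ^ p.2)
    (g' := fun (p : ℕ × ℕ) y' => A p.1 p.2 * x ^ p.1 * ((p.2 : ℝ) * y' ^ (p.2 - 1)))
    (u := fun p : ℕ × ℕ => |(p.2 : ℝ) * A p.1 p.2| * |x| ^ p.1 * (|y| + 1) ^ p.2 * (1 / (|y| + 1)))
    (t := Metric.ball 0 (|y| + 1)) (y₀ := y) (y := y)
    ((h.muln.summable_abs |x| (|y| + 1) (abs_nonneg _) hx hR.le).mul_right _)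
    Metric.isOpen_ball (convex_ball _ _).isPreconnected
    (fun p z _ => (hasDerivAt_pow p.2 z).const_mul _)
    (fun p z hz => by
      have hz' : |z| ≤ |y| + 1 := by
        have := mem_ball_zero_iff.1 hz
        exact this.le
      have := pow_bound z _ hR hz' p.2
      rw [Real.norm_eq_abs, abs_mul, abs_mul, abs_pow]
      calc |A p.1 p.2| * |x| ^ p.1 * |(p.2 : ℝ) * z ^ (p.2 - 1)|
          ≤ |A p.1 p.2| * |x| ^ p.1 * (p.2 * (|y| + 1) ^ p.2 * (1 / (|y| + 1))) := by gcongr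
        _ = _ := by
          rw [abs_mul, abs_of_nonneg (by positivity : (0:ℝ) ≤ (p.2 : ℝ))]; ring)
    (by simp) (h.summable x y hx) (by simp)
  suffices e : SS (_root_.DDy A) x y =
      ∑' p : ℕ × ℕ, A p.1 p.2 * x ^ p.1 * ((p.2 : ℝ) * y ^ (p.2 - 1)) by
    rw [e]; exact key
  rw [← tsum_shift _ (by simp)]
  refine tsum_congr fun p => ?_
  simp [_root_.DDy]
  ring

lemma Good.hasDerivAt_x {A : ℕ → ℕ → ℝ} (h : Good A) (x y : ℝ) (hx : |x| < 1) :
    HasDerivAt (fun x' => SS A x' y)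
      (∑' p : ℕ × ℕ, A p.1 p.2 * ((p.1 : ℝ) * x ^ (p.1 - 1)) * y ^ p.2) x := by
  obtain ⟨r, hr, hr1⟩ := exists_between hx
  have hr0 : 0 < r := (abs_nonneg x).trans_lt hr
  exact hasDerivAt_tsum_of_isPreconnected
    (g := fun (p : ℕ × ℕ) x' => A p.1 p.2 * x' ^ p.1 * y ^ p.2)
    (g' := fun (p : ℕ × ℕ) x' => A p.1 p.2 * ((p.1 : ℝ) * x' ^ (p.1 - 1)) * y ^ p.2)
    (u := fun p : ℕ × ℕ => |(p.1 : ℝ) * A p.1 p.2| * r ^ p.1 * |y| ^ p.2 * (1 / r))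
    (t := Metric.ball 0 r) (y₀ := x) (y := x)
    ((h.mulm.summable_abs r |y| hr0.le hr1 (abs_nonneg _)).mul_right _)
    Metric.isOpen_ball (convex_ball _ _).isPreconnected
    (fun p z _ => ((hasDerivAt_pow p.1 z).const_mul _).mul_const _)
    (fun p z hz => by
      have hz' : |z| ≤ r := by
        have := mem_ball_zero_iff.1 hz
        exact this.le
      have := pow_bound z _ hr0 hz' p.1
      rw [Real.norm_eq_abs, abs_mul, abs_mul, abs_pow]
      calc |A p.1 p.2| * |(p.1 : ℝ) * z ^ (p.1 - 1)| * |y| ^ p.2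
          ≤ |A p.1 p.2| * (p.1 * r ^ p.1 * (1 / r)) * |y| ^ p.2 := by gcongr
        _ = _ := by
          rw [abs_mul, abs_of_nonneg (by positivity : (0:ℝ) ≤ (p.1 : ℝ))]; ring)
    (by simpa using hr) (h.summable x y hx) (by simpa using hr)

lemma Good.x_deriv_x {A : ℕ → ℕ → ℝ} (h : Good A) (x y : ℝ) (hx : |x| < 1) :
    x * deriv (fun x' => SS A x' y) x = SS (fun m n => (m : ℝ) * A m n) x y := by
  rw [(h.hasDerivAt_x x y hx).deriv, ← tsum_mul_left]
  refine tsum_congr fun p => ?_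
  rcases p with ⟨m, n⟩
  cases m with
  | zero => simp
  | succ m => simp only [Nat.add_sub_cancel]; ring

lemma y_DDy (A : ℕ → ℕ → ℝ) (x y : ℝ) :
    y * SS (DDy A) x y = SS (fun m n => (n : ℝ) * A m n) x y := by
  unfold SS
  rw [← tsum_mul_left, ← tsum_shift (fun p : ℕ × ℕ => (p.2 : ℝ) * A p.1 p.2 * x ^ p.1 * y ^ p.2)
    (by simp)]
  refine tsum_congr fun p => ?_
  simp [DDy]
  ring

lemma seq_bound (u t : ℕ → ℝ) (q : ℝ) (hq : 1 < q) (hu : ∀ n, u (n + 1) = u n * t n)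
    (ht : Filter.Tendsto t Filter.atTop (nhds 1)) : ∃ C : ℝ, 0 ≤ C ∧ ∀ n, |u n| ≤ C * q ^ n := by
  have h1 : ∀ᶠ n in Filter.atTop, |t n| < q := by
    have := ht.abs
    rw [abs_one] at this
    exact this.eventually_lt_const hq
  obtain ⟨N, hN⟩ := Filter.eventually_atTop.1 h1
  have hq0 : 0 < q := by linarith
  refine ⟨∑ i ∈ Finset.range (N + 1), |u i|, Finset.sum_nonneg fun _ _ => abs_nonneg _, ?_⟩
  intro n
  induction n with
  | zero =>
    simp only [pow_zero, mul_one]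
    exact Finset.single_le_sum (f := fun i => |u i|) (fun _ _ => abs_nonneg _) (by simp)
  | succ n ih =>
    by_cases hn : n < N
    · have h2 : |u (n + 1)| ≤ ∑ i ∈ Finset.range (N + 1), |u i| :=
        Finset.single_le_sum (f := fun i => |u i|) (fun _ _ => abs_nonneg _) (by simp; omega)
      refine h2.trans (le_mul_of_one_le_right (Finset.sum_nonneg fun _ _ => abs_nonneg _) ?_)
      exact one_le_pow₀ hq.le
    · rw [hu, abs_mul, pow_succ, ← mul_assoc]
      have := (hN n (by omega)).le
      gcongr

lemma tendsto_ratio (a c : ℝ) :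
    Filter.Tendsto (fun n : ℕ => (a + n) / (c + n)) Filter.atTop (nhds 1) := by
  have h := tendsto_add_mul_div_add_mul_atTop_nhds a c 1 (d := (1:ℝ)) one_ne_zero
  simpa using h

lemma poch_succ (a : ℝ) (n : ℕ) : poch a (n + 1) = poch a n * (a + n) := by
  simp [poch, Finset.prod_range_succ]

lemma poch_ne (a : ℝ) (ha : ∀ k : ℕ, a ≠ -(k : ℝ)) (n : ℕ) : poch a n ≠ 0 := by
  unfold poch
  rw [Finset.prod_ne_zero_iff]
  intro i _ h
  exact ha i (by linarith)

lemma poch_bound (a q : ℝ) (hq : 1 < q) :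
    ∃ C : ℝ, 0 ≤ C ∧ ∀ n : ℕ, |poch a n / n.factorial| ≤ C * q ^ n := by
  refine seq_bound _ (fun n : ℕ => (a + n) / (1 + n)) q hq (fun n => ?_) (tendsto_ratio a 1)
  rw [poch_succ, Nat.factorial_succ, div_mul_div_comm]
  push_cast
  ring_nf

lemma poch_inv_bound (a q : ℝ) (hq : 1 < q) :
    ∃ C : ℝ, 0 ≤ C ∧ ∀ n : ℕ, |n.factorial / poch a n| ≤ C * q ^ n := by
  refine seq_bound _ (fun n : ℕ => (1 + n) / (a + n)) q hq (fun n => ?_) (tendsto_ratio 1 a)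
  rw [poch_succ, Nat.factorial_succ, div_mul_div_comm]
  push_cast
  ring_nf

lemma fact_bound (ρ : ℝ) (hρ : 0 < ρ) :
    ∃ C : ℝ, 0 ≤ C ∧ ∀ n : ℕ, 1 / (n.factorial : ℝ) ≤ C * ρ ^ n := by
  refine ⟨Real.exp (1 / ρ), (Real.exp_pos _).le, fun n => ?_⟩
  have := Real.pow_div_factorial_le_exp (1 / ρ) (by positivity) n
  calc 1 / (n.factorial : ℝ) = (1 / ρ) ^ n / n.factorial * ρ ^ n := by
        rw [div_pow, one_pow]; field_simp
    _ ≤ _ := by gcongr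

def AA (b c d e g : ℝ) (m n : ℕ) : ℝ :=
  poch b m * poch c m * poch d n / (poch e (m + n) * poch g n * m.factorial * n.factorial)

lemma AA_good (b c d e g : ℝ) : Good (AA b c d e g) := by
  intro q0 hq0 ρ hρ
  obtain ⟨q, hq, hqq⟩ : ∃ q : ℝ, 1 < q ∧ q ^ 3 = q0 := by
    refine ⟨q0 ^ ((1:ℝ) / 3), Real.one_lt_rpow hq0 (by norm_num), ?_⟩
    rw [← Real.rpow_natCast, ← Real.rpow_mul (by linarith)]
    norm_num
  have hqp : 0 < q := by linarith
  obtain ⟨C1, h1, H1⟩ := poch_bound b q hq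
  obtain ⟨C2, h2, H2⟩ := poch_bound c q hq
  obtain ⟨C3, h3, H3⟩ := poch_bound d q hq
  obtain ⟨C4, h4, H4⟩ := poch_inv_bound e q hq
  obtain ⟨C5, h5, H5⟩ := poch_inv_bound g q hq
  obtain ⟨C6, h6, H6⟩ := fact_bound (ρ / q ^ 3) (by positivity)
  refine ⟨C1 * C2 * C3 * C4 * C5 * C6, by positivity, fun m n => ?_⟩
  have e1 : AA b c d e g m n = (poch b m / m.factorial) * (poch c m / m.factorial) *
      (poch d n / n.factorial) * ((m + n).factorial / poch e (m + n)) *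
      (n.factorial / poch g n) * ((m.factorial / (m + n).factorial) * (1 / n.factorial)) := by
    unfold AA
    have := Nat.factorial_ne_zero m
    have := Nat.factorial_ne_zero n
    have := Nat.factorial_ne_zero (m + n)
    field_simp
  have e2 : |((m.factorial : ℝ) / (m + n).factorial) * (1 / n.factorial)|
      ≤ C6 * (ρ / q ^ 3) ^ n := by
    rw [abs_of_nonneg (by positivity)]
    refine le_trans (mul_le_of_le_one_left (by positivity) ?_) (H6 n)
    apply div_le_one_of_le₀ _ (by positivity)
    exact_mod_cast Nat.factorial_le (Nat.le_add_right m n)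
  rw [e1]
  simp only [abs_mul _ (_ * (1 / _) : ℝ), abs_mul _ (_ / _ : ℝ)] at e2 ⊢
  calc _ ≤ (C1 * q ^ m) * (C2 * q ^ m) * (C3 * q ^ n) * (C4 * q ^ (m + n)) * (C5 * q ^ n) *
        (C6 * (ρ / q ^ 3) ^ n) := by
        gcongr
        · exact H1 m
        · exact H2 m
        · exact H3 n
        · exact H4 (m + n)
        · exact H5 n
    _ = C1 * C2 * C3 * C4 * C5 * C6 * (q ^ 3) ^ m * ρ ^ n := by
        rw [div_pow, pow_add]
        field_simp
        ring
    _ = _ := by rw [hqq]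

lemma F021_eq (b c d e g x y : ℝ) : F021 b c d e g x y = SS (AA b c d e g) x y := rfl

lemma AA_rec (b c d e g : ℝ)
    (he : ∀ k : ℕ, e ≠ -(k : ℝ)) (hg : ∀ k : ℕ, g ≠ -(k : ℝ)) (m n : ℕ) :
    DDy (AA b c d e g) m n * ((e + m + n) * (g + n)) = (d + n) * AA b c d e g m n := by
  have p1 := poch_ne e he (m + n)
  have p2 := poch_ne g hg n
  have p3 : e + (m + n) ≠ 0 := fun h => he (m + n) (by push_cast; linarith)
  have p4 : g + n ≠ 0 := fun h => hg n (by linarith)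
  have := Nat.factorial_ne_zero m
  have := Nat.factorial_ne_zero n
  have p5 : (n : ℝ) + 1 ≠ 0 := by positivity
  unfold DDy AA
  rw [← add_assoc, poch_succ, poch_succ, poch_succ, Nat.factorial_succ]
  push_cast
  rw [add_assoc e]
  field_simp

/-- The function `z(x,y) = F^{0;2;1}_{1;0;1}[-: b,c; d; e: -; g; x,y]` satisfies, for
`|x| < 1` and all `y`, the third-order equation
`y² z_yyy + x y z_xyy + g x z_xy + (e+g+1) y z_yy + (eg - y) z_y - d z = 0`. -/
theorem F021_pde_second (b c d e g : ℝ)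
    (he : ∀ k : ℕ, e ≠ -(k : ℝ)) (hg : ∀ k : ℕ, g ≠ -(k : ℝ))
    (x y : ℝ) (hx : |x| < 1) :
    y ^ 2 * deriv (deriv (deriv (fun y' : ℝ => F021 b c d e g x y'))) y +
      x * y *
        deriv (fun x' : ℝ => deriv (deriv (fun y' : ℝ => F021 b c d e g x' y')) y) x +
      g * x * deriv (fun x' : ℝ => deriv (fun y' : ℝ => F021 b c d e g x' y') y) x +
      (e + g + 1) * y * deriv (deriv (fun y' : ℝ => F021 b c d e g x y')) y +
      (e * g - y) * deriv (fun y' : ℝ => F021 b c d e g x y') y -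
      d * F021 b c d e g x y = 0 := by
  set A := AA b c d e g with hA
  have gA : Good A := AA_good b c d e g
  have gB := gA.DDy
  have gC := gB.DDy
  have d1 : ∀ x' : ℝ, |x'| < 1 →
      deriv (fun y' : ℝ => F021 b c d e g x' y') = fun y' => SS (DDy A) x' y' := by
    intro x' hx'
    funext y'
    exact (gA.hasDerivAt_y x' y' hx').deriv
  have d2 : ∀ x' : ℝ, |x'| < 1 →
      deriv (deriv (fun y' : ℝ => F021 b c d e g x' y')) = fun y' => SS (DDy (DDy A)) x' y' := by
    intro x' hx'
    rw [d1 x' hx']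
    funext y'
    exact (gB.hasDerivAt_y x' y' hx').deriv
  have d3 : deriv (deriv (deriv (fun y' : ℝ => F021 b c d e g x y'))) y
      = SS (DDy (DDy (DDy A))) x y := by
    rw [d2 x hx]
    exact (gC.hasDerivAt_y x y hx).deriv
  have hev : ∀ᶠ x' in nhds x, |x'| < 1 := continuous_abs.continuousAt.eventually_lt_const hx
  have d4 : deriv (fun x' : ℝ => deriv (deriv (fun y' : ℝ => F021 b c d e g x' y')) y) x
      = deriv (fun x' => SS (DDy (DDy A)) x' y) x := by
    apply Filter.EventuallyEq.deriv_eq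
    filter_upwards [hev] with x' hx'
    rw [d2 x' hx']
  have d5 : deriv (fun x' : ℝ => deriv (fun y' : ℝ => F021 b c d e g x' y') y) x
      = deriv (fun x' => SS (DDy A) x' y) x := by
    apply Filter.EventuallyEq.deriv_eq
    filter_upwards [hev] with x' hx'
    rw [d1 x' hx']
  have x4 := gC.x_deriv_x x y hx
  have x5 := gB.x_deriv_x x y hx
  rw [d3, d4, d5, d2 x hx, d1 x hx, F021_eq, ← hA]
  set B := DDy A with hB
  have y4 := y_DDy (fun m n => (m : ℝ) * B m n) x y
  have r4 : DDy (fun m n => (m : ℝ) * B m n) = fun (m n : ℕ) => (m : ℝ) * DDy B m n := by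
    funext m n; simp only [DDy]; ring
  rw [r4, ← x4] at y4
  have y1 := y_DDy A x y
  rw [← hB] at y1
  have y2 := y_DDy B x y
  have y3 := y_DDy (DDy B) x y
  have y3' := y_DDy (fun m n => ((n : ℝ) - 1) * B m n) x y
  have r3 : DDy (fun m n => ((n : ℝ) - 1) * B m n) = fun (m n : ℕ) => (n : ℝ) * DDy B m n := by
    funext m n; simp only [DDy]; push_cast; ring
  rw [r3, ← y3] at y3'
  have gn2 : Good (fun m n => (n : ℝ) * (((n : ℝ) - 1) * B m n)) := by
    have : Good (fun m n => ((n : ℝ) - 1) * B m n) := by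
      have := gB.muln.sub gB
      simpa only [sub_mul, one_mul] using this
    exact this.muln
  have s1 := gn2.hasSum x y hx
  have s2 := gB.mulm.muln.hasSum x y hx
  have s3 := (gB.mulm.hasSum x y hx).mul_left g
  have s4 := (gB.muln.hasSum x y hx).mul_left (e + g + 1)
  have s5 := (gB.hasSum x y hx).mul_left (e * g)
  have s6 := gA.muln.hasSum x y hx
  have s7 := (gA.hasSum x y hx).mul_left d
  have s := (((((s1.add s2).add s3).add s4).add s5).sub s6).sub s7
  have z := s.unique (by
    convert hasSum_zero using 1
    funext p
    have hr := AA_rec b c d e g he hg p.1 p.2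
    rw [← hA, ← hB] at hr
    linear_combination (x ^ p.1 * y ^ p.2) * hr)
  rw [← y3', ← y4, ← x5, ← y2, ← y1] at z
  linear_combination z

end
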